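/- For every real λ > 0, every h > 0 and every α with 0 < α < 1, one has the integral representation (1 + h λ^α)^{-1} = (sin(απ)/(απ)) · ∫₀^∞ ρ^{1/α} / ((ρ^{1/α} + h^{1/α} λ)(1 + 2ρ cos(απ) + ρ²)) dρ. -/

import Mathlib

open Real MeasureTheory

namespace KatoAux
open Complex Filter Topology

noncomputable def F (α : ℝ) (w : ℂ) : ℂ := (1 + Complex.exp (α * w))⁻¹
noncomputable def H (α L : ℝ) (w : ℂ) : ℂ :=
  Complex.exp w * (dslope (F α) L w / dslope Complex.exp L w)
noncomputable def P (α c : ℝ) (u : ℝ) : ℝ :=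
  Real.exp u * Real.exp (α * u) /
    ((Real.exp u + c) * (1 + 2 * Real.exp (α * u) * Real.cos (α * π) + Real.exp (α * u) ^ 2))

lemma den_pos {α : ℝ} (h0 : 0 < α) (h1 : α < 1) (r : ℝ) :
    0 < 1 + 2 * r * Real.cos (α * π) + r ^ 2 := by
  have hs : 0 < Real.sin (α * π) := Real.sin_pos_of_pos_of_lt_pi (by positivity)
    (by nlinarith [Real.pi_pos])
  have := Real.sin_sq_add_cos_sq (α * π)
  have h2 : 0 < Real.sin (α * π) ^ 2 := by positivity
  nlinarith [sq_nonneg (r + Real.cos (α * π))]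

lemma one_add_ne {α : ℝ} (h0 : 0 < α) (h1 : α < 1) {w : ℂ} (hw : |w.im| ≤ π) :
    1 + Complex.exp (α * w) ≠ 0 := by
  intro h
  have h' : Complex.exp (α * w) = Complex.exp (π * I) := by
    rw [Complex.exp_pi_mul_I]; linear_combination h
  obtain ⟨n, hn⟩ := Complex.exp_eq_exp_iff_exists_int.1 h'
  have him := congrArg Complex.im hn
  simp at him
  have h3 : |α * w.im| < π := by
    rw [abs_mul, abs_of_pos h0]
    nlinarith [Real.pi_pos, abs_nonneg w.im]
  rw [him, abs_lt] at h3
  have hp := Real.pi_pos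
  have a1 : (n : ℝ) < 0 := by by_contra hc; push Not at hc; nlinarith
  have a2 : (-1 : ℝ) < n := by by_contra hc; push Not at hc; nlinarith
  have : n < 0 := by exact_mod_cast a1
  have : -1 < n := by exact_mod_cast a2
  omega

lemma exp_ne {L : ℝ} {w : ℂ} (hw : |w.im| ≤ π) (hne : w ≠ L) :
    Complex.exp w ≠ Complex.exp L := by
  intro h
  obtain ⟨n, hn⟩ := Complex.exp_eq_exp_iff_exists_int.1 h
  have him := congrArg Complex.im hn
  simp at him
  have hp := Real.pi_pos
  rw [him, abs_le] at hw
  have a1 : (n : ℝ) < 1 := by by_contra hc; push Not at hc; nlinarith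
  have a2 : (-1 : ℝ) < n := by by_contra hc; push Not at hc; nlinarith
  have : n < 1 := by exact_mod_cast a1
  have : -1 < n := by exact_mod_cast a2
  have : n = 0 := by omega
  subst this
  apply hne
  simpa using hn

lemma F_diff {α : ℝ} (h0 : 0 < α) (h1 : α < 1) {w : ℂ} (hw : |w.im| ≤ π) :
    DifferentiableAt ℂ (F α) w := by
  unfold F
  exact DifferentiableAt.inv (by fun_prop) (one_add_ne h0 h1 hw)

lemma H_eq (α L : ℝ) {w : ℂ} (hne : w ≠ L) :
    H α L w = Complex.exp w * ((F α w - F α L) / (Complex.exp w - Complex.exp L)) := by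
  unfold H
  rw [dslope_of_ne _ hne, dslope_of_ne _ hne, slope_def_field, slope_def_field,
    div_div_div_cancel_right₀ (sub_ne_zero.2 hne)]

lemma dslope_exp_ne {L : ℝ} {w : ℂ} (hw : |w.im| ≤ π) : dslope Complex.exp L w ≠ 0 := by
  by_cases h : w = L
  · subst h; simp
  · rw [dslope_of_ne _ h, slope_def_field]
    exact div_ne_zero (sub_ne_zero.2 (exp_ne hw h)) (sub_ne_zero.2 h)

lemma H_diff {α L : ℝ} (h0 : 0 < α) (h1 : α < 1) {w : ℂ} (hw : |w.im| ≤ π) (hne : w ≠ L) :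
    DifferentiableAt ℂ (H α L) w := by
  unfold H
  exact Complex.differentiable_exp.differentiableAt.mul
    (((differentiableAt_dslope_of_ne hne).2 (F_diff h0 h1 hw)).div
      ((differentiableAt_dslope_of_ne hne).2 Complex.differentiable_exp.differentiableAt)
      (dslope_exp_ne hw))

lemma H_cont {α L : ℝ} (h0 : 0 < α) (h1 : α < 1) {w : ℂ} (hw : |w.im| ≤ π) :
    ContinuousAt (H α L) w := by
  by_cases h : w = L
  · subst h
    unfold H
    exact Complex.continuous_exp.continuousAt.mul
      ((continuousAt_dslope_same.2 (F_diff h0 h1 hw)).div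
      (continuousAt_dslope_same.2 Complex.differentiable_exp.differentiableAt)
      (dslope_exp_ne hw))
  · exact (H_diff h0 h1 hw h).continuousAt

lemma rect {α : ℝ} (L : ℝ) (h0 : 0 < α) (h1 : α < 1) (R : ℝ) :
    (∫ x in (-R)..R, H α L (x + (-π : ℝ) * I)) - (∫ x in (-R)..R, H α L (x + π * I)) +
      I • (∫ y in (-π)..π, H α L (R + y * I)) -
      I • (∫ y in (-π)..π, H α L ((-R : ℝ) + y * I)) = 0 := by
  have key := Complex.integral_boundary_rect_eq_zero_of_differentiable_on_off_countable (H α L)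
    (⟨-R, -π⟩ : ℂ) ⟨R, π⟩ {(L : ℂ)} (Set.countable_singleton _) ?_ ?_
  · exact key
  · intro w hw
    apply (H_cont h0 h1 _).continuousWithinAt
    rw [Complex.mem_reProdIm] at hw
    have := hw.2
    rw [Set.uIcc_of_le (by simp; linarith [Real.pi_pos])] at this
    exact abs_le.2 this
  · intro w hw
    have h2 := hw.1
    rw [Complex.mem_reProdIm] at h2
    have := h2.2
    simp only [] at this
    rw [min_eq_left (by linarith [Real.pi_pos]), max_eq_right (by linarith [Real.pi_pos])] at this
    exact H_diff h0 h1 (abs_le.2 ⟨this.1.le, this.2.le⟩) hw.2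

lemma jump {α : ℝ} (L : ℝ) (h0 : 0 < α) (h1 : α < 1) (x : ℝ) :
    H α L (x + (-π : ℝ) * I) - H α L (x + π * I) =
      2 * I * Real.sin (α * π) * (P α (Real.exp L) x : ℝ) := by
  have hp := Real.pi_pos
  have n1 : (x + (-π : ℝ) * I : ℂ) ≠ L := by
    intro h; have := congrArg Complex.im h; simp at this
  have n2 : (x + π * I : ℂ) ≠ L := by
    intro h; have := congrArg Complex.im h; simp at this
  have e1 : Complex.exp (x + (-π : ℝ) * I) = -Complex.exp x := by
    rw [Complex.exp_add]; simp [Complex.exp_neg]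
  have e2 : Complex.exp (x + π * I) = -Complex.exp x := by
    rw [Complex.exp_add]; simp
  have o1 := one_add_ne h0 h1 (w := x + (-π : ℝ) * I) (by simp [abs_of_pos hp])
  have o2 := one_add_ne h0 h1 (w := x + π * I) (by simp [abs_of_pos hp])
  have q1 : Complex.exp (α * (x + (-π : ℝ) * I)) =
      Complex.exp (α * x) * (Complex.cos (α * π) - Complex.sin (α * π) * I) := by
    have h2 := Complex.exp_mul_I (-(α * π))
    rw [Complex.cos_neg, Complex.sin_neg] at h2
    rw [sub_eq_add_neg, ← neg_mul, ← h2, ← Complex.exp_add]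
    congr 1; push_cast; ring
  have q2 : Complex.exp (α * (x + π * I)) =
      Complex.exp (α * x) * (Complex.cos (α * π) + Complex.sin (α * π) * I) := by
    rw [← Complex.exp_mul_I, ← Complex.exp_add]
    congr 1; ring
  have hd : (Complex.exp x + Complex.exp L) ≠ 0 := by
    have : Real.exp x + Real.exp L ≠ 0 := by positivity
    exact_mod_cast this
  have hD : (1 + 2 * Complex.exp (α * x) * Complex.cos (α * π) + Complex.exp (α * x) ^ 2) ≠ 0 := by
    have := (den_pos h0 h1 (Real.exp (α * x))).ne'
    exact_mod_cast this
  rw [H_eq _ _ n1, H_eq _ _ n2, e1, e2]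
  unfold F P
  rw [q1] at o1
  rw [q2] at o2
  rw [q1, q2]
  push_cast
  have hsc := Complex.sin_sq_add_cos_sq (α * π)
  generalize Complex.exp (α * x) = E at *
  generalize Complex.cos (α * π) = C at *
  generalize Complex.sin (α * π) = S at *
  have hdiff : (1 + E * (C - S * I))⁻¹ - (1 + E * (C + S * I))⁻¹ =
      2 * I * S * E / (1 + 2 * E * C + E ^ 2) := by
    rw [inv_sub_inv o1 o2]
    congr 1
    · ring
    · linear_combination E ^ 2 * hsc - E^2 * S^2 * I_sq
  have hd' : -Complex.exp x - Complex.exp L ≠ 0 := by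
    intro h; apply hd; linear_combination -h
  have : ∀ A B K X Y : ℂ, X + Y ≠ 0 → -X * ((A - K) / (-X - Y)) - -X * ((B - K) / (-X - Y)) =
      X / (X + Y) * (A - B) := by
    intro A B K X Y h
    have : -X - Y = -(X + Y) := by ring
    rw [this]; field_simp; ring
  rw [this _ _ _ _ _ hd, hdiff]
  field_simp

lemma right_bound {α L : ℝ} (h0 : 0 < α) {R : ℝ} (hR : 0 < R) (hL : L < R) (y : ℝ) :
    ‖H α L (R + y * I) + F α L‖ ≤
      ((Real.exp (α * R) - 1)⁻¹ + Real.exp L * ‖F α L‖ * Real.exp (-R)) /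
        (1 - Real.exp L * Real.exp (-R)) := by
  have n1 : (R + y * I : ℂ) ≠ L := by
    intro h; have := congrArg Complex.re h; simp at this; linarith
  set w : ℂ := R + y * I with hw
  have hre : w.re = R := by simp [hw]
  have ne : ‖Complex.exp w‖ = Real.exp R := by rw [Complex.norm_exp, hre]
  have nL : ‖Complex.exp (L : ℂ)‖ = Real.exp L := by rw [Complex.norm_exp]; simp
  have na : ‖Complex.exp (α * w)‖ = Real.exp (α * R) := by rw [Complex.norm_exp]; simp [hre]
  have hlt : Real.exp L < Real.exp R := Real.exp_lt_exp.2 hL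
  have h1 : 1 < Real.exp (α * R) := Real.one_lt_exp_iff.2 (by positivity)
  have hF : ‖F α w‖ ≤ (Real.exp (α * R) - 1)⁻¹ := by
    unfold F
    rw [norm_inv]
    apply inv_anti₀ (by linarith)
    have := norm_sub_le_norm_add (Complex.exp (α * w)) 1
    rw [na, norm_one] at this
    rwa [add_comm]
  have hD : Real.exp R - Real.exp L ≤ ‖Complex.exp w - Complex.exp L‖ := by
    have := norm_sub_norm_le (Complex.exp w) (Complex.exp L)
    rwa [ne, nL] at this
  have hD0 : Complex.exp w - Complex.exp L ≠ 0 := by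
    rw [← norm_pos_iff]; linarith
  have e : H α L w + F α L = (Complex.exp w * F α w - Complex.exp L * F α L) /
      (Complex.exp w - Complex.exp L) := by
    rw [H_eq _ _ n1]; field_simp; ring
  rw [e, norm_div]
  calc _ ≤ (Real.exp R * (Real.exp (α * R) - 1)⁻¹ + Real.exp L * ‖F α L‖) /
        (Real.exp R - Real.exp L) := by
        apply div_le_div₀ _ _ (by linarith) hD
        · have : 0 < Real.exp (α * R) - 1 := by linarith
          positivity
        · refine (norm_sub_le _ _).trans ?_
          rw [norm_mul, norm_mul, ne, nL]
          gcongr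
    _ = _ := by
        rw [Real.exp_neg]
        have : Real.exp R - Real.exp L ≠ 0 := by linarith
        have : Real.exp (α * R) - 1 ≠ 0 := by linarith
        have : 1 - Real.exp L * (Real.exp R)⁻¹ ≠ 0 := by
          have hh : Real.exp L * (Real.exp R)⁻¹ < 1 := by
            rw [← div_eq_mul_inv, div_lt_one (Real.exp_pos _)]; exact hlt
          linarith
        have hE := (Real.exp_pos R).ne'
        field_simp

lemma left_bound {α L : ℝ} (h0 : 0 < α) {R : ℝ} (hR : 0 < R) (hL : -L < R) (y : ℝ) :
    ‖H α L ((-R : ℝ) + y * I)‖ ≤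
      Real.exp (-R) * (((1 - Real.exp (-(α * R)))⁻¹ + ‖F α L‖) /
        (Real.exp L - Real.exp (-R))) := by
  have n1 : ((-R : ℝ) + y * I : ℂ) ≠ L := by
    intro h; have := congrArg Complex.re h; simp at this; linarith
  set w : ℂ := (-R : ℝ) + y * I with hw
  have hre : w.re = -R := by simp [hw]
  have ne : ‖Complex.exp w‖ = Real.exp (-R) := by rw [Complex.norm_exp, hre]
  have nL : ‖Complex.exp (L : ℂ)‖ = Real.exp L := by rw [Complex.norm_exp]; simp
  have na : ‖Complex.exp (α * w)‖ = Real.exp (-(α * R)) := by rw [Complex.norm_exp]; simp [hre]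
  have hlt : Real.exp (-R) < Real.exp L := Real.exp_lt_exp.2 (by linarith)
  have h1 : Real.exp (-(α * R)) < 1 := by
    have h3 : 0 < α * R := by positivity
    simpa using Real.exp_lt_exp.2 (show -(α * R) < 0 by linarith)
  have h2 : 0 < 1 - Real.exp (-(α * R)) := by linarith
  have hF : ‖F α w‖ ≤ (1 - Real.exp (-(α * R)))⁻¹ := by
    unfold F
    rw [norm_inv]
    apply inv_anti₀ h2
    have := norm_sub_le_norm_add 1 (Complex.exp (α * w))
    rwa [na, norm_one] at this
  have hD : Real.exp L - Real.exp (-R) ≤ ‖Complex.exp w - Complex.exp L‖ := by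
    have := norm_sub_norm_le (Complex.exp L) (Complex.exp w)
    rwa [ne, nL, norm_sub_rev] at this
  rw [H_eq _ _ n1, norm_mul, norm_div, ne]
  have hD2 : 0 < Real.exp L - Real.exp (-R) := by linarith
  gcongr
  exact (norm_sub_le _ _).trans (by gcongr)

lemma exp_tends : Tendsto (fun R : ℝ => Real.exp (-R)) atTop (𝓝 0) :=
  Real.tendsto_exp_neg_atTop_nhds_zero

lemma right_lim {α : ℝ} (L : ℝ) (h0 : 0 < α) (h1 : α < 1) :
    Tendsto (fun R : ℝ => ∫ y in (-π)..π, H α L (R + y * I)) atTop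
      (𝓝 (-(2 * π * F α L))) := by
  rw [tendsto_iff_norm_sub_tendsto_zero]
  have hb : Tendsto (fun R : ℝ => ((Real.exp (α * R) - 1)⁻¹ + Real.exp L * ‖F α L‖ * Real.exp (-R)) /
        (1 - Real.exp L * Real.exp (-R)) * |π - -π|) atTop (𝓝 0) := by
    have t1 : Tendsto (fun R : ℝ => (Real.exp (α * R) - 1)⁻¹) atTop (𝓝 0) := by
      apply Tendsto.inv_tendsto_atTop
      apply tendsto_atTop_add_const_right
      exact Real.tendsto_exp_atTop.comp (tendsto_id.const_mul_atTop h0)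
    have := (((t1.add (exp_tends.const_mul (Real.exp L * ‖F α L‖))).div
      ((tendsto_const_nhds (x := (1:ℝ))).sub (exp_tends.const_mul (Real.exp L)))
      (by simp)).mul_const |π - -π|)
    simpa using this
  refine squeeze_zero' (Eventually.of_forall fun _ => norm_nonneg _) ?_ hb
  filter_upwards [eventually_gt_atTop 0, eventually_gt_atTop L] with R hR hL
  have hi : IntervalIntegrable (fun y : ℝ => H α L (R + y * I)) volume (-π) π := by
    apply ContinuousOn.intervalIntegrable
    intro y hy
    rw [Set.uIcc_of_le (by linarith [Real.pi_pos])] at hy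
    apply ContinuousAt.continuousWithinAt
    apply ContinuousAt.comp (g := H α L) (f := fun y : ℝ => (R + y * I : ℂ))
    · exact H_cont h0 h1 (by simpa using abs_le.2 hy)
    · fun_prop
  have : (∫ y in (-π)..π, H α L (R + y * I)) - -(2 * π * F α L) =
      ∫ y in (-π)..π, (H α L (R + y * I) + F α L) := by
    rw [intervalIntegral.integral_add hi (by simp), intervalIntegral.integral_const]
    simp only [Complex.real_smul]; push_cast; ring
  rw [this]
  exact intervalIntegral.norm_integral_le_of_norm_le_const fun y _ => right_bound h0 hR hL y

lemma left_lim {α : ℝ} (L : ℝ) (h0 : 0 < α) :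
    Tendsto (fun R : ℝ => ∫ y in (-π)..π, H α L ((-R : ℝ) + y * I)) atTop (𝓝 0) := by
  rw [tendsto_zero_iff_norm_tendsto_zero]
  have hb : Tendsto (fun R : ℝ => Real.exp (-R) * (((1 - Real.exp (-(α * R)))⁻¹ + ‖F α L‖) /
        (Real.exp L - Real.exp (-R))) * |π - -π|) atTop (𝓝 0) := by
    have t1 : Tendsto (fun R : ℝ => Real.exp (-(α * R))) atTop (𝓝 0) :=
      exp_tends.comp (tendsto_id.const_mul_atTop h0)
    have t2 := ((tendsto_const_nhds (x := (1:ℝ))).sub t1).inv₀ (by simp)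
    have := (exp_tends.mul ((t2.add_const ‖F α L‖).div
      ((tendsto_const_nhds (x := Real.exp L)).sub exp_tends)
      (by simp))).mul_const |π - -π|
    simpa using this
  refine squeeze_zero' (Eventually.of_forall fun _ => norm_nonneg _) ?_ hb
  filter_upwards [eventually_gt_atTop 0, eventually_gt_atTop (-L)] with R hR hL
  exact intervalIntegral.norm_integral_le_of_norm_le_const fun y _ => left_bound h0 hR hL y

lemma P_cont {α c : ℝ} (h0 : 0 < α) (h1 : α < 1) (hc : 0 < c) : Continuous (P α c) := by
  unfold P
  refine Continuous.div (by fun_prop) (by fun_prop) fun x => ?_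
  have := den_pos h0 h1 (Real.exp (α * x))
  positivity

lemma P_nonneg {α c : ℝ} (h0 : 0 < α) (h1 : α < 1) (hc : 0 < c) (x : ℝ) : 0 ≤ P α c x := by
  unfold P
  have := den_pos h0 h1 (Real.exp (α * x))
  positivity

lemma hor {α : ℝ} (L : ℝ) (h0 : 0 < α) (h1 : α < 1) (R : ℝ) :
    (∫ x in (-R)..R, H α L (x + (-π : ℝ) * I)) - (∫ x in (-R)..R, H α L (x + π * I)) =
    2 * I * Real.sin (α * π) * ((∫ x in (-R)..R, P α (Real.exp L) x : ℝ) : ℂ) := by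
  have hp := Real.pi_pos
  have hi : ∀ t : ℝ, |t| ≤ π →
      IntervalIntegrable (fun x : ℝ => H α L (x + t * I)) volume (-R) R := by
    intro t ht
    apply Continuous.intervalIntegrable
    rw [continuous_iff_continuousAt]
    intro x
    apply ContinuousAt.comp (g := H α L) (f := fun x : ℝ => (x + t * I : ℂ))
    · exact H_cont h0 h1 (by simpa using ht)
    · fun_prop
  rw [← intervalIntegral.integral_sub (hi _ (by simp [abs_of_pos hp])) (hi _ (abs_of_pos hp).le),
    ← intervalIntegral.integral_ofReal, ← intervalIntegral.integral_const_mul]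
  exact intervalIntegral.integral_congr fun x _ => jump L h0 h1 x

lemma sin_pos' {α : ℝ} (h0 : 0 < α) (h1 : α < 1) : 0 < Real.sin (α * π) :=
  Real.sin_pos_of_pos_of_lt_pi (by positivity) (by nlinarith [Real.pi_pos])

lemma F_real (α L : ℝ) : F α L = (((1 + Real.exp (α * L))⁻¹ : ℝ) : ℂ) := by
  unfold F; push_cast; rfl

lemma P_lim {α : ℝ} (L : ℝ) (h0 : 0 < α) (h1 : α < 1) :
    Tendsto (fun R : ℝ => ∫ x in (-R)..R, P α (Real.exp L) x) atTop
      (𝓝 (π * (1 + Real.exp (α * L))⁻¹ / Real.sin (α * π))) := by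
  have hs := (sin_pos' h0 h1).ne'
  have hs' : (Real.sin (α * π) : ℂ) ≠ 0 := by exact_mod_cast hs
  have key : ∀ R : ℝ, ((∫ x in (-R)..R, P α (Real.exp L) x : ℝ) : ℂ) =
      ((∫ y in (-π)..π, H α L ((-R : ℝ) + y * I)) - (∫ y in (-π)..π, H α L (R + y * I))) /
        (2 * Real.sin (α * π)) := by
    intro R
    have h := rect L h0 h1 R
    rw [hor L h0 h1 R, smul_eq_mul, smul_eq_mul] at h
    rw [eq_div_iff (by simpa using hs')]
    apply mul_left_cancel₀ I_ne_zero
    linear_combination h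
  have t : Tendsto (fun R : ℝ => ((∫ x in (-R)..R, P α (Real.exp L) x : ℝ) : ℂ)) atTop
      (𝓝 ((π * (1 + Real.exp (α * L))⁻¹ / Real.sin (α * π) : ℝ) : ℂ)) := by
    simp_rw [key]
    convert ((left_lim L h0).sub (right_lim L h0 h1)).div_const (2 * (Real.sin (α * π) : ℂ)) using 2
    rw [F_real]
    push_cast at hs' ⊢
    simp only [div_eq_mul_inv, mul_inv]
    ring
  exact_mod_cast (Complex.continuous_re.tendsto _).comp t

lemma P_int {α : ℝ} (L : ℝ) (h0 : 0 < α) (h1 : α < 1) :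
    ∫ x, P α (Real.exp L) x = π * (1 + Real.exp (α * L))⁻¹ / Real.sin (α * π) := by
  have hL := Real.exp_pos L
  have hi : Integrable (P α (Real.exp L)) := by
    refine integrable_of_intervalIntegral_norm_tendsto (l := atTop) (a := fun R : ℝ => -R)
      (b := fun R => R)
      (π * (1 + Real.exp (α * L))⁻¹ / Real.sin (α * π)) (fun R => ?_) tendsto_neg_atTop_atBot tendsto_id ?_
    · exact (P_cont h0 h1 hL).integrableOn_Ioc
    · simp_rw [Real.norm_of_nonneg (P_nonneg h0 h1 hL _)]
      exact P_lim L h0 h1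
  exact tendsto_nhds_unique
    (intervalIntegral_tendsto_integral hi tendsto_neg_atTop_atBot tendsto_id) (P_lim L h0 h1)

end KatoAux

/-- Integral representation of the resolvent of the fractional power (Kato). -/
theorem stmt_0 (lam h α : ℝ) (hlam : 0 < lam) (hh : 0 < h) (hα0 : 0 < α) (hα1 : α < 1) :
    (1 + h * lam ^ α)⁻¹ =
      Real.sin (α * π) / (α * π) *
        ∫ ρ in Set.Ioi (0 : ℝ),
          ρ ^ (1 / α) /
            ((ρ ^ (1 / α) + h ^ (1 / α) * lam) *
              (1 + 2 * ρ * Real.cos (α * π) + ρ ^ 2)) := by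
  have hc : 0 < h ^ (1 / α) * lam := by positivity
  have himg : (fun u : ℝ => Real.exp (α * u)) '' Set.univ = Set.Ioi 0 := by
    ext r
    simp only [Set.image_univ, Set.mem_range, Set.mem_Ioi]
    constructor
    · rintro ⟨u, rfl⟩; positivity
    · intro hr
      exact ⟨Real.log r / α, by rw [mul_div_cancel₀ _ hα0.ne', Real.exp_log hr]⟩
  have hcv := integral_image_eq_integral_abs_deriv_smul (s := Set.univ)
    (f := fun u : ℝ => Real.exp (α * u)) (f' := fun u => Real.exp (α * u) * α) MeasurableSet.univ
    (fun x _ => by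
      have := ((hasDerivAt_id x).const_mul α).exp
      simpa using this)
    (fun x _ y _ hxy => by
      have := Real.exp_injective hxy
      exact mul_left_cancel₀ hα0.ne' this)
    (fun ρ => ρ ^ (1 / α) / ((ρ ^ (1 / α) + h ^ (1 / α) * lam) *
              (1 + 2 * ρ * Real.cos (α * π) + ρ ^ 2)))
  rw [himg] at hcv
  rw [hcv, setIntegral_univ]
  have hP : ∀ u : ℝ, |Real.exp (α * u) * α| • (Real.exp (α * u) ^ (1 / α) /
      ((Real.exp (α * u) ^ (1 / α) + h ^ (1 / α) * lam) *
        (1 + 2 * Real.exp (α * u) * Real.cos (α * π) + Real.exp (α * u) ^ 2))) =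
      α * KatoAux.P α (Real.exp (Real.log (h ^ (1 / α) * lam))) u := by
    intro u
    rw [Real.exp_log hc, ← Real.exp_mul, show α * u * (1 / α) = u by field_simp,
      abs_of_pos (by positivity), smul_eq_mul]
    unfold KatoAux.P
    ring
  simp_rw [hP]
  rw [integral_const_mul, KatoAux.P_int _ hα0 hα1]
  have hs := (KatoAux.sin_pos' hα0 hα1).ne'
  have hpow : Real.exp (α * Real.log (h ^ (1 / α) * lam)) = h * lam ^ α := by
    rw [mul_comm, Real.exp_mul, Real.exp_log hc, Real.mul_rpow (by positivity) hlam.le,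
      ← Real.rpow_mul hh.le, one_div_mul_cancel hα0.ne', Real.rpow_one]
  rw [hpow]
  have := Real.pi_pos.ne'
  have : 1 + h * lam ^ α ≠ 0 := by positivity
  field_simp
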